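/- arXiv:1405.1879 — 3 statements merged into one kernel-verified Lean document; each statement's English description precedes it below -/
import Mathlib

section
/- Let n ≥ 1 and p ≥ 1 be integers, and let R and G be real n×n matrices with R symmetric positive semidefinite, such that the 2n×2n block matrix [[R, G],[G', R]] is positive semidefinite. Let τ > 0 and let a_0, a_1, …, a_p be positive real numbers with a_0 + a_1 + … + a_p = τ, and let δ_0, δ_1, …, δ_p ∈ ℝⁿ. Then τ · Σ_{ν=0}^{p} (1/a_ν) δ_ν'Rδ_ν ≥ δ'Ψδ, where δ = (δ_0', δ_1', …, δ_p')' ∈ ℝ^{(p+1)n} and Ψ is the (p+1)×(p+1) block matrix whose diagonal n×n blocks all equal R and whose off-diagonal n×n blocks all equal (G+G')/2. -/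
open Matrix

abbrev Vec (n : ℕ) := Fin n → ℝ
abbrev Mat (n : ℕ) := Matrix (Fin n) (Fin n) ℝ

/-- The `(p+1)×(p+1)` block matrix `Ψ` with diagonal `n×n` blocks `R` and all
off-diagonal blocks `(G + Gᵀ)/2`. -/
noncomputable def PsiBlk (n p : ℕ) (R G : Mat n) :
    Matrix (Fin (p + 1) × Fin n) (Fin (p + 1) × Fin n) ℝ :=
  Matrix.of fun q r => if q.1 = r.1 then R q.2 r.2 else ((G + Gᵀ) q.2 r.2) / 2

/-- The `(p+1)n × (p+2)n` block first-difference matrix `T`: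
`T_{ν,ν} = I`, `T_{ν,ν+1} = −I`, zero otherwise. -/
def Tdiff (n p : ℕ) : Matrix (Fin (p + 1) × Fin n) (Fin (p + 2) × Fin n) ℝ :=
  Matrix.of fun q r =>
    if r.1 = q.1.castSucc ∧ r.2 = q.2 then 1
    else if r.1 = q.1.succ ∧ r.2 = q.2 then -1 else 0

/-- `Ψ̄ = e^{−2ατ} T'ΨT`. -/
noncomputable def PsiBar (n p : ℕ) (R G : Mat n) (α τ : ℝ) :
    Matrix (Fin (p + 2) × Fin n) (Fin (p + 2) × Fin n) ℝ :=
  Real.exp (-2 * α * τ) • ((Tdiff n p)ᵀ * PsiBlk n p R G * Tdiff n p)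

/-- `Ψ̃`: equal to `Ψ̄` except that its (1,1) block is `Ψ̄₁₁ − 2αY⁻¹ − S` and its
(3,3) block is `Ψ̄₃₃ + e^{−2ατ}S` (block partition sizes `(n, p·n, n)`). -/
noncomputable def PsiTilde (n p : ℕ) (R G Y S : Mat n) (α τ : ℝ) :
    Matrix (Fin (p + 2) × Fin n) (Fin (p + 2) × Fin n) ℝ :=
  Matrix.of fun q r =>
    PsiBar n p R G α τ q r
      + (if q.1 = 0 ∧ r.1 = 0 then ((-(2 * α)) • Y⁻¹ - S) q.2 r.2 else 0)
      + (if q.1 = Fin.last (p + 1) ∧ r.1 = Fin.last (p + 1)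
          then Real.exp (-2 * α * τ) * S q.2 r.2 else 0)

/-- Assemble the stacked vector `ē = (b; c 0; …; c (p−1); d) ∈ ℝ^{(p+2)n}`. -/
def assemble (n p : ℕ) (b : Vec n) (c : Fin p → Vec n) (d : Vec n) :
    Fin (p + 2) × Fin n → ℝ :=
  fun q =>
    if h0 : q.1.val = 0 then b q.2
    else if hl : q.1.val ≤ p then c ⟨q.1.val - 1, by omega⟩ q.2
    else d q.2

/-- The Lyapunov–Krasovskii functional
`V(u) = e(u)'Y⁻¹e(u) + ∫_{u−τ}^u e^{−2α(u−s)} e(s)'S e(s) ds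
      + τ ∫_{u−τ}^u e^{−2α(u−s)} (τ+s−u) ė(s)'R ė(s) ds`. -/
noncomputable def LK (n : ℕ) (Y S R : Mat n) (α τ : ℝ) (e de : ℝ → Vec n) (u : ℝ) : ℝ :=
  e u ⬝ᵥ (Y⁻¹ *ᵥ e u)
    + ∫ s in (u - τ)..u, Real.exp (-2 * α * (u - s)) * (e s ⬝ᵥ (S *ᵥ e s))
    + τ * ∫ s in (u - τ)..u,
        Real.exp (-2 * α * (u - s)) * (τ + s - u) * (de s ⬝ᵥ (R *ᵥ de s))

/-- Sample-time index: during `[t_k, t_{k+1})`, a node with in-degree `p` uses, for its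
`μ`-th neighbour (0-indexed position in its ordered neighbourhood), the sample taken at
time `t_{k − ((μ+k) mod p)}` (Round-Robin rule, `ν_j^{k,i} = ((μ+k) mod p) + 1`). -/
def sIdx (p k μ : ℕ) : ℤ := (k : ℤ) - (((μ + k) % p : ℕ) : ℤ)

/-- Reciprocal convexity: a positive semidefinite block matrix `[[R, G], [Gᵀ, R]]` bounds the
cross term `x'Gy` by the weighted diagonal terms. -/
theorem Matrix.PosSemidef.two_mul_cross_le {ι : Type*} [Fintype ι] {R G : Matrix ι ι ℝ}
    (h : (fromBlocks R G Gᵀ R).PosSemidef) {s t : ℝ} (hs : 0 < s) (ht : 0 < t) (x y : ι → ℝ) :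
    2 * (x ⬝ᵥ (G *ᵥ y)) ≤ t / s * (x ⬝ᵥ (R *ᵥ x)) + s / t * (y ⬝ᵥ (R *ᵥ y)) := by
  have key := h.dotProduct_mulVec_nonneg (Sum.elim (t • x) (-(s • y)))
  have hG : y ⬝ᵥ (Gᵀ *ᵥ x) = x ⬝ᵥ (G *ᵥ y) := by
    rw [mulVec_transpose, dotProduct_comm, ← dotProduct_mulVec]
  rw [star_trivial, fromBlocks_mulVec] at key
  simp only [Sum.elim_comp_inl, Sum.elim_comp_inr, sumElim_dotProduct_sumElim, mulVec_neg,
    mulVec_smul, dotProduct_add, dotProduct_neg, neg_dotProduct, dotProduct_smul, smul_dotProduct,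
    smul_eq_mul, hG] at key
  have hst := mul_pos hs ht
  refine le_of_mul_le_mul_left ?_ hst
  have e : s * t * (t / s * (x ⬝ᵥ (R *ᵥ x)) + s / t * (y ⬝ᵥ (R *ᵥ y)))
      = t ^ 2 * (x ⬝ᵥ (R *ᵥ x)) + s ^ 2 * (y ⬝ᵥ (R *ᵥ y)) := by
    field_simp
  rw [e]
  linarith

/-- The quadratic form of `PsiBlk` as a double sum over its blocks. -/
theorem dotProduct_PsiBlk_mulVec (n p : ℕ) (R G : Mat n) (δ : Fin (p + 1) → Vec n) :
    (fun q : Fin (p + 1) × Fin n => δ q.1 q.2) ⬝ᵥ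
        (PsiBlk n p R G *ᵥ fun q => δ q.1 q.2)
      = ∑ ν, ∑ μ, if ν = μ then δ ν ⬝ᵥ (R *ᵥ δ ν)
          else (δ ν ⬝ᵥ (G *ᵥ δ μ) + δ μ ⬝ᵥ (G *ᵥ δ ν)) / 2 := by
  simp only [dotProduct, mulVec, Fintype.sum_prod_type, Finset.mul_sum]
  refine Finset.sum_congr rfl fun ν _ => ?_
  rw [Finset.sum_comm]
  refine Finset.sum_congr rfl fun μ _ => ?_
  simp only [PsiBlk, of_apply]
  split_ifs with h
  · subst h
    rfl
  · rw [Finset.sum_comm (f := fun i j => δ μ i * (G i j * δ ν j))]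
    simp only [← Finset.sum_add_distrib, Finset.sum_div, Matrix.add_apply, transpose_apply]
    exact Finset.sum_congr rfl fun i _ => Finset.sum_congr rfl fun j _ => by ring

/-- Lemma 1. If `R ⪰ 0` and `[[R,G],[G',R]] ⪰ 0`, `τ > 0`,
`a_0,…,a_p > 0` with `∑ a_ν = τ`, and `δ_0,…,δ_p ∈ ℝⁿ`, then
`τ ∑_ν (1/a_ν) δ_ν'Rδ_ν ≥ δ'Ψδ`. -/
theorem stmt3 (n p : ℕ) (hn : 1 ≤ n) (hp : 1 ≤ p)
    (R G : Mat n) (hR : R.PosSemidef)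
    (hPark : (Matrix.fromBlocks R G Gᵀ R).PosSemidef)
    (τ : ℝ) (hτ : 0 < τ)
    (a : Fin (p + 1) → ℝ) (ha : ∀ ν, 0 < a ν) (hsum : ∑ ν, a ν = τ)
    (δ : Fin (p + 1) → Vec n) :
    (fun q : Fin (p + 1) × Fin n => δ q.1 q.2) ⬝ᵥ
        (PsiBlk n p R G *ᵥ fun q => δ q.1 q.2)
      ≤ τ * ∑ ν, (1 / a ν) * (δ ν ⬝ᵥ (R *ᵥ δ ν)) := by
  rw [dotProduct_PsiBlk_mulVec]
  have term (ν μ : Fin (p + 1)) :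
      (if ν = μ then δ ν ⬝ᵥ (R *ᵥ δ ν) else (δ ν ⬝ᵥ (G *ᵥ δ μ) + δ μ ⬝ᵥ (G *ᵥ δ ν)) / 2)
        ≤ (a μ / a ν * (δ ν ⬝ᵥ (R *ᵥ δ ν)) + a ν / a μ * (δ μ ⬝ᵥ (R *ᵥ δ μ))) / 2 := by
    split_ifs with h
    · subst h
      rw [div_self (ha ν).ne']
      linarith
    · linarith [hPark.two_mul_cross_le (ha ν) (ha μ) (δ ν) (δ μ),
        hPark.two_mul_cross_le (ha μ) (ha ν) (δ μ) (δ ν)]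
  have total : τ * ∑ ν, (1 / a ν) * (δ ν ⬝ᵥ (R *ᵥ δ ν))
      = ∑ ν, ∑ μ, a μ / a ν * (δ ν ⬝ᵥ (R *ᵥ δ ν)) := by
    rw [Finset.mul_sum]
    refine Finset.sum_congr rfl fun ν _ => ?_
    rw [← hsum, Finset.sum_mul]
    exact Finset.sum_congr rfl fun μ _ => by ring
  refine (Finset.sum_le_sum fun ν _ => Finset.sum_le_sum fun μ _ => term ν μ).trans_eq ?_
  simp only [← Finset.sum_div, Finset.sum_add_distrib]
  rw [total, Finset.sum_comm (f := fun ν μ => a ν / a μ * (δ μ ⬝ᵥ (R *ᵥ δ μ)))]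
  ring
end

section
/- Let W be a real n×n symmetric positive semidefinite matrix, let τ > 0, let a < b be real numbers with b − a ≤ τ, and let e : ℝ → ℝⁿ be continuously differentiable on [a, b]. Then ∫_a^b [ τ² ė(t)'W ė(t) − (π²/4)(e(t) − e(a))'W(e(t) − e(a)) ] dt ≥ 0. -/
open Matrix

lemma hasDerivAt_mul_tan_mul_sub (k b t : ℝ) (h : Real.cos (k * (b - t)) ≠ 0) :
    HasDerivAt (fun s => k * Real.tan (k * (b - s)))
      (-k ^ 2 - (k * Real.tan (k * (b - t))) ^ 2) t := by
  have hinner : HasDerivAt (fun s => k * (b - s)) (-k) t := by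
    simpa using ((hasDerivAt_id t).const_sub b).const_mul k
  have := ((Real.hasDerivAt_tan h).comp t hinner).const_mul k
  refine this.congr_deriv ?_
  rw [Real.tan_eq_sin_div_cos]
  field_simp
  linear_combination k ^ 2 * Real.sin_sq_add_cos_sq (k * (b - t))

/-- Subcritical form of Wirtinger's inequality, obtained by completing the square with the
solution `k * tan (k * (b - t))` of the Riccati equation `y' = -k ^ 2 - y ^ 2`. -/
lemma integral_deriv_sq_sub_mul_sq_nonneg {a b k : ℝ} {f f' : ℝ → ℝ} (hab : a ≤ b)
    (hk : 0 ≤ k) (hkab : k * (b - a) < Real.pi / 2) (hfa : f a = 0)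
    (hderiv : ∀ t ∈ Set.Icc a b, HasDerivWithinAt f (f' t) (Set.Icc a b) t)
    (hcont : ContinuousOn f' (Set.Icc a b)) :
    0 ≤ ∫ t in a..b, (f' t ^ 2 - k ^ 2 * f t ^ 2) := by
  have hf : ContinuousOn f (Set.Icc a b) := fun t ht => (hderiv t ht).continuousWithinAt
  have hcos : ∀ t ∈ Set.Icc a b, Real.cos (k * (b - t)) ≠ 0 := by
    intro t ht
    refine (Real.cos_pos_of_mem_Ioo ⟨?_, ?_⟩).ne'
    · have := mul_nonneg hk (sub_nonneg.2 ht.2)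
      linarith [Real.pi_pos]
    · have := mul_le_mul_of_nonneg_left (sub_le_sub_left ht.1 b) hk
      linarith
  set φ : ℝ → ℝ := fun t => k * Real.tan (k * (b - t)) with hφ
  have hφ' : ∀ t ∈ Set.Icc a b, HasDerivAt φ (-k ^ 2 - φ t ^ 2) t := fun t ht =>
    hasDerivAt_mul_tan_mul_sub k b t (hcos t ht)
  have hφc : ContinuousOn φ (Set.Icc a b) := fun t ht =>
    (hφ' t ht).continuousAt.continuousWithinAt
  have hint : ∫ t in a..b, ((-k ^ 2 - φ t ^ 2) * f t ^ 2 + φ t * (2 * f t * f' t)) = 0 := by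
    rw [intervalIntegral.integral_eq_sub_of_hasDerivAt_of_le hab
      (f := fun t => φ t * f t ^ 2) (hφc.mul (hf.pow 2))]
    · simp [hφ, hfa]
    · intro t ht
      have hft := (hderiv t (Set.Ioo_subset_Icc_self ht)).hasDerivAt
        (Icc_mem_nhds ht.1 ht.2)
      refine ((hφ' t (Set.Ioo_subset_Icc_self ht)).mul (hft.pow 2)).congr_deriv ?_
      simp
    · apply ContinuousOn.intervalIntegrable
      rw [Set.uIcc_of_le hab]
      fun_prop
  have hsplit : ∫ t in a..b, (f' t ^ 2 - k ^ 2 * f t ^ 2)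
      = (∫ t in a..b, (f' t - φ t * f t) ^ 2)
        + ∫ t in a..b, ((-k ^ 2 - φ t ^ 2) * f t ^ 2 + φ t * (2 * f t * f' t)) := by
    rw [← intervalIntegral.integral_add]
    · congr 1
      ext t
      ring
    all_goals
      apply ContinuousOn.intervalIntegrable
      rw [Set.uIcc_of_le hab]
      fun_prop
  rw [hsplit, hint, add_zero]
  exact intervalIntegral.integral_nonneg hab fun t _ => sq_nonneg _

/-- Wirtinger's inequality for a `C¹` function vanishing at the left endpoint. -/
lemma integral_wirtinger_nonneg {τ a b : ℝ} {f f' : ℝ → ℝ} (hτ : 0 < τ) (hab : a ≤ b)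
    (hba : b - a ≤ τ) (hfa : f a = 0)
    (hderiv : ∀ t ∈ Set.Icc a b, HasDerivWithinAt f (f' t) (Set.Icc a b) t)
    (hcont : ContinuousOn f' (Set.Icc a b)) :
    0 ≤ ∫ t in a..b, (τ ^ 2 * f' t ^ 2 - Real.pi ^ 2 / 4 * f t ^ 2) := by
  have hf : ContinuousOn f (Set.Icc a b) := fun t ht => (hderiv t ht).continuousWithinAt
  have hI : IntervalIntegrable (fun t => f t ^ 2) MeasureTheory.volume a b := by
    apply ContinuousOn.intervalIntegrable
    rw [Set.uIcc_of_le hab]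
    fun_prop
  have hI' : IntervalIntegrable (fun t => f' t ^ 2) MeasureTheory.volume a b := by
    apply ContinuousOn.intervalIntegrable
    rw [Set.uIcc_of_le hab]
    fun_prop
  have hsub : ∀ k ∈ Set.Ioo 0 (Real.pi / (2 * τ)),
      0 ≤ (∫ t in a..b, f' t ^ 2) - k ^ 2 * ∫ t in a..b, f t ^ 2 := by
    intro k hk
    rw [← intervalIntegral.integral_const_mul,
      ← intervalIntegral.integral_sub hI' (hI.const_mul _)]
    refine integral_deriv_sq_sub_mul_sq_nonneg hab hk.1.le ?_ hfa hderiv hcont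
    have h1 := mul_le_mul_of_nonneg_left hba hk.1.le
    have h2 := (lt_div_iff₀ (by positivity)).1 hk.2
    linarith
  have hpos : 0 < Real.pi / (2 * τ) := by positivity
  have hlim : 0 ≤ (∫ t in a..b, f' t ^ 2)
      - (Real.pi / (2 * τ)) ^ 2 * ∫ t in a..b, f t ^ 2 := by
    refine le_on_closure (f := fun _ => 0) (s := Set.Ioo 0 (Real.pi / (2 * τ)))
      (g := fun k => (∫ t in a..b, f' t ^ 2) - k ^ 2 * ∫ t in a..b, f t ^ 2)
      hsub (by fun_prop) (by fun_prop) ?_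
    rw [closure_Ioo hpos.ne]
    exact ⟨hpos.le, le_rfl⟩
  rw [intervalIntegral.integral_sub (hI'.const_mul _) (hI.const_mul _),
    intervalIntegral.integral_const_mul, intervalIntegral.integral_const_mul]
  have hscale : τ ^ 2 * (Real.pi / (2 * τ)) ^ 2 = Real.pi ^ 2 / 4 := by
    field_simp
    norm_num
  have := mul_nonneg (sq_nonneg τ) hlim
  rwa [mul_sub, ← mul_assoc, hscale] at this

/-- scaled Wirtinger inequality. If `W ⪰ 0`, `0 < τ`, `a < b`,
`b − a ≤ τ`, and `e` is continuously differentiable on `[a,b]` with derivative `e'`, then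
`∫_a^b [τ² e'(t)'W e'(t) − (π²/4)(e(t)−e(a))'W(e(t)−e(a))] dt ≥ 0`. -/
theorem stmt9 (n : ℕ) (W : Matrix (Fin n) (Fin n) ℝ) (hW : W.PosSemidef)
    (τ a b : ℝ) (hτ : 0 < τ) (hab : a < b) (hba : b - a ≤ τ)
    (e e' : ℝ → Fin n → ℝ)
    (hderiv : ∀ t ∈ Set.Icc a b, HasDerivWithinAt e (e' t) (Set.Icc a b) t)
    (hcont : ContinuousOn e' (Set.Icc a b)) :
    0 ≤ ∫ t in a..b,
        (τ ^ 2 * (e' t ⬝ᵥ (W *ᵥ e' t))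
          - (Real.pi ^ 2 / 4) * ((e t - e a) ⬝ᵥ (W *ᵥ (e t - e a)))) := by
  obtain ⟨B, rfl⟩ : ∃ B : Matrix (Fin n) (Fin n) ℝ, W = Bᵀ * B := by
    open scoped MatrixOrder in
    simpa [star_eq_conjTranspose] using CStarAlgebra.nonneg_iff_eq_star_mul_self.mp hW.nonneg
  have hquad : ∀ v : Fin n → ℝ, v ⬝ᵥ ((Bᵀ * B) *ᵥ v) = ∑ i, (B *ᵥ v) i ^ 2 := by
    intro v
    rw [← mulVec_mulVec, dotProduct_mulVec, vecMul_transpose]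
    simp [dotProduct, sq]
  let L : Fin n → (Fin n → ℝ) →L[ℝ] ℝ := fun i =>
    (ContinuousLinearMap.proj i).comp (LinearMap.toContinuousLinearMap B.mulVecLin)
  have hL : ∀ i v, (B *ᵥ v) i = L i v := fun i v => rfl
  have hLderiv : ∀ i, ∀ t ∈ Set.Icc a b,
      HasDerivWithinAt (fun t => L i (e t - e a)) (L i (e' t)) (Set.Icc a b) t := fun i t ht =>
    (L i).hasFDerivAt.comp_hasDerivWithinAt t ((hderiv t ht).sub_const (e a))
  have hLcont : ∀ i, ContinuousOn (fun t => L i (e' t)) (Set.Icc a b) := fun i =>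
    (L i).continuous.comp_continuousOn hcont
  have he : ContinuousOn e (Set.Icc a b) := fun t ht => (hderiv t ht).continuousWithinAt
  simp only [hquad, hL, Finset.mul_sum, ← Finset.sum_sub_distrib]
  rw [intervalIntegral.integral_finsetSum]
  · exact Finset.sum_nonneg fun i _ => integral_wirtinger_nonneg
      (f := fun t => L i (e t - e a)) hτ hab.le hba (by simp) (hLderiv i) (hLcont i)
  · intro i _
    apply ContinuousOn.intervalIntegrable
    rw [Set.uIcc_of_le hab.le]
    fun_prop
end

section
/- Let W be a real n×n symmetric positive semidefinite matrix, let τ > 0 and T > 0, and let 0 = s_0 < s_1 < … < s_m = T be a partition of [0, T] with s_{d+1} − s_d ≤ τ for every d = 0, …, m−1. Let e : ℝ → ℝⁿ be continuously differentiable on [0, T], and let h : [0, T) → ℝⁿ be the left-endpoint sample-and-hold of e, i.e. h(t) = e(s_d) for t ∈ [s_d, s_{d+1}). Then ∫_0^T [ τ² ė(t)'W ė(t) − (π²/4)(e(t) − h(t))'W(e(t) − h(t)) ] dt ≥ 0. -/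
open Matrix
open Set MeasureTheory Filter Topology

/-- A Wirtinger-type inequality for `q = Q ∘ f` and `p = Q ∘ f'`, where `Q` is a nonnegative
quadratic form: it needs only that the polynomial `p - x r + x² q`, with `r = q'`, is nonnegative. -/
lemma sq_mul_integral_le_of_hasDerivAt {a b c : ℝ} (hab : a ≤ b) (hc : 0 ≤ c)
    (hcb : c * (b - a) < Real.pi / 2) {p q r : ℝ → ℝ}
    (hp : ContinuousOn p (Icc a b)) (hq : ContinuousOn q (Icc a b))
    (hqr : ∀ t ∈ Ioo a b, HasDerivAt q (r t) t) (hqa : q a = 0)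
    (hpos : ∀ t ∈ Icc a b, ∀ x : ℝ, 0 ≤ p t - x * r t + x ^ 2 * q t) :
    c ^ 2 * ∫ t in a..b, q t ≤ ∫ t in a..b, p t := by
  have hcos : ∀ t ∈ Icc a b, 0 < Real.cos (c * (b - t)) := fun t ht ↦ by
    apply Real.cos_pos_of_mem_Ioo
    constructor <;> nlinarith [ht.1, ht.2, Real.pi_pos, mul_nonneg hc (sub_nonneg.2 ht.1),
      mul_nonneg hc (sub_nonneg.2 ht.2)]
  have htan : ∀ t ∈ Icc a b, HasDerivAt (fun t ↦ c * Real.tan (c * (b - t)))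
      (c * (1 / Real.cos (c * (b - t)) ^ 2 * (c * (-1)))) t := fun t ht ↦
    (HasDerivAt.comp t (h₂ := Real.tan) (h := fun t ↦ c * (b - t))
      (Real.hasDerivAt_tan (hcos t ht).ne')
      (((hasDerivAt_id t).const_sub b).const_mul c)).const_mul c
  have hcont : ContinuousOn (fun t ↦ c * Real.tan (c * (b - t)) * q t) (Icc a b) :=
    ContinuousOn.mul (fun t ht ↦ (htan t ht).continuousAt.continuousWithinAt) hq
  have hpi : IntervalIntegrable p volume a b := hp.intervalIntegrable_of_Icc hab
  have hqi : IntervalIntegrable q volume a b := hq.intervalIntegrable_of_Icc hab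
  have key := intervalIntegral.sub_le_integral_of_hasDeriv_right_of_le hab hcont
    (fun t ht ↦ ((htan t (Ioo_subset_Icc_self ht)).mul (hqr t ht)).hasDerivWithinAt)
    (φ := fun t ↦ p t - c ^ 2 * q t)
    ((hp.sub (continuousOn_const.mul hq)).integrableOn_Icc) (fun t ht ↦ by
      have ht' := Ioo_subset_Icc_self ht
      have h1 := hpos t ht' (c * Real.tan (c * (b - t)))
      have h2 : 1 / Real.cos (c * (b - t)) ^ 2 = 1 + Real.tan (c * (b - t)) ^ 2 := by
        have := (hcos t ht').ne'
        rw [Real.tan_eq_sin_div_cos]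
        field_simp
        linarith [Real.sin_sq_add_cos_sq (c * (b - t))]
      rw [h2]
      linarith)
  rw [intervalIntegral.integral_sub hpi (hqi.const_mul _),
    intervalIntegral.integral_const_mul] at key
  simp only [sub_self, mul_zero, Real.tan_zero, zero_mul, hqa] at key
  linarith

lemma pi_sq_div_four_mul_integral_le_of_hasDerivAt {a b τ : ℝ} (hab : a ≤ b) (hτ : 0 < τ)
    (hbτ : b - a ≤ τ) {p q r : ℝ → ℝ}
    (hp : ContinuousOn p (Icc a b)) (hq : ContinuousOn q (Icc a b))
    (hqr : ∀ t ∈ Ioo a b, HasDerivAt q (r t) t) (hqa : q a = 0)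
    (hpos : ∀ t ∈ Icc a b, ∀ x : ℝ, 0 ≤ p t - x * r t + x ^ 2 * q t) :
    0 ≤ ∫ t in a..b, (τ ^ 2 * p t - (Real.pi ^ 2 / 4) * q t) := by
  have hpi : IntervalIntegrable p volume a b := hp.intervalIntegrable_of_Icc hab
  have hqi : IntervalIntegrable q volume a b := hq.intervalIntegrable_of_Icc hab
  have hc0 : 0 < Real.pi / (2 * τ) := by positivity
  have key : (Real.pi / (2 * τ)) ^ 2 * ∫ t in a..b, q t ≤ ∫ t in a..b, p t := by
    have hlim : Tendsto (fun c : ℝ ↦ c ^ 2 * ∫ t in a..b, q t) (𝓝[<] (Real.pi / (2 * τ)))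
        (𝓝 ((Real.pi / (2 * τ)) ^ 2 * ∫ t in a..b, q t)) :=
      (Continuous.tendsto (by fun_prop) _).mono_left nhdsWithin_le_nhds
    refine le_of_tendsto hlim ?_
    filter_upwards [Ioo_mem_nhdsLT hc0] with c hc
    refine sq_mul_integral_le_of_hasDerivAt hab hc.1.le ?_ hp hq hqr hqa hpos
    calc c * (b - a) ≤ c * τ := mul_le_mul_of_nonneg_left hbτ hc.1.le
      _ < Real.pi / (2 * τ) * τ := mul_lt_mul_of_pos_right hc.2 hτ
      _ = Real.pi / 2 := by field_simp
  rw [intervalIntegral.integral_sub (hpi.const_mul _) (hqi.const_mul _),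
    intervalIntegral.integral_const_mul, intervalIntegral.integral_const_mul]
  have h1 := mul_le_mul_of_nonneg_left key (sq_nonneg τ)
  have h2 : τ ^ 2 * ((Real.pi / (2 * τ)) ^ 2 * ∫ t in a..b, q t)
      = Real.pi ^ 2 / 4 * ∫ t in a..b, q t := by
    field_simp
    ring
  linarith

lemma HasDerivAt.dotProduct_real {ι : Type*} [Fintype ι] {f g : ℝ → ι → ℝ} {f' g' : ι → ℝ} {t : ℝ}
    (hf : HasDerivAt f f' t) (hg : HasDerivAt g g' t) :
    HasDerivAt (fun t ↦ f t ⬝ᵥ g t) (f' ⬝ᵥ g t + f t ⬝ᵥ g') t := by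
  rw [hasDerivAt_pi] at hf hg
  simp only [dotProduct, ← Finset.sum_add_distrib]
  exact HasDerivAt.fun_sum fun i _ ↦ (hf i).mul (hg i)

lemma HasDerivAt.mulVec_real {ι : Type*} [Fintype ι] (W : Matrix ι ι ℝ) {f : ℝ → ι → ℝ}
    {f' : ι → ℝ} {t : ℝ} (hf : HasDerivAt f f' t) :
    HasDerivAt (fun t ↦ W *ᵥ f t) (W *ᵥ f') t :=
  ((Matrix.mulVecLin W).toContinuousLinearMap.hasFDerivAt).comp_hasDerivAt t hf

lemma Matrix.PosSemidef.integral_sub_sample_nonneg {ι : Type*} [Fintype ι] {W : Matrix ι ι ℝ}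
    (hW : W.PosSemidef) {a b τ : ℝ} (hab : a ≤ b) (hτ : 0 < τ) (hbτ : b - a ≤ τ)
    {e e' : ℝ → ι → ℝ} (he : ContinuousOn e (Icc a b)) (he' : ContinuousOn e' (Icc a b))
    (hderiv : ∀ t ∈ Ioo a b, HasDerivAt e (e' t) t) :
    0 ≤ ∫ t in a..b, (τ ^ 2 * (e' t ⬝ᵥ (W *ᵥ e' t))
      - (Real.pi ^ 2 / 4) * ((e t - e a) ⬝ᵥ (W *ᵥ (e t - e a)))) := by
  have hQ : Continuous fun v : ι → ℝ ↦ v ⬝ᵥ (W *ᵥ v) := by fun_prop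
  refine pi_sq_div_four_mul_integral_le_of_hasDerivAt hab hτ hbτ
    (p := fun t ↦ e' t ⬝ᵥ (W *ᵥ e' t))
    (q := fun t ↦ (e t - e a) ⬝ᵥ (W *ᵥ (e t - e a)))
    (r := fun t ↦ e' t ⬝ᵥ (W *ᵥ (e t - e a)) + (e t - e a) ⬝ᵥ (W *ᵥ e' t))
    (hQ.comp_continuousOn he') (hQ.comp_continuousOn (he.sub continuousOn_const))
    (fun t ht ↦ ?_) (by simp) (fun t _ x ↦ ?_)
  · have h1 := (hderiv t ht).sub_const (e a)
    exact h1.dotProduct_real (h1.mulVec_real W)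
  · have h1 := hW.dotProduct_mulVec_nonneg (e' t - x • (e t - e a))
    simp only [star_trivial] at h1
    generalize e t - e a = v at h1 ⊢
    simp only [Matrix.mulVec_sub, Matrix.mulVec_smul, dotProduct_sub, sub_dotProduct,
      smul_dotProduct, dotProduct_smul, smul_eq_mul] at h1
    linarith

/-- integral nonnegativity of the generalized supply-rate terms.
If `W ⪰ 0`, `0 < τ`, `0 < T`, `0 = s₀ < s₁ < … < s_m = T` is a partition of `[0,T]`
with all subinterval lengths at most `τ`, `e` is continuously differentiable on `[0,T]`
with derivative `e'`, and `h` is the left-endpoint sample-and-hold of `e` along the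
partition, then
`∫_0^T [τ² e'(t)'W e'(t) − (π²/4)(e(t)−h(t))'W(e(t)−h(t))] dt ≥ 0`. -/
theorem stmt10 (n : ℕ) (W : Matrix (Fin n) (Fin n) ℝ) (hW : W.PosSemidef)
    (τ T : ℝ) (hτ : 0 < τ) (hT : 0 < T)
    (m : ℕ) (s : Fin (m + 1) → ℝ) (hs0 : s 0 = 0) (hsm : s (Fin.last m) = T)
    (hmono : StrictMono s)
    (hstep : ∀ d : Fin m, s d.succ - s d.castSucc ≤ τ)
    (e e' : ℝ → Fin n → ℝ)
    (hderiv : ∀ t ∈ Set.Icc (0 : ℝ) T, HasDerivWithinAt e (e' t) (Set.Icc (0 : ℝ) T) t)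
    (hcont : ContinuousOn e' (Set.Icc (0 : ℝ) T))
    (h : ℝ → Fin n → ℝ)
    (hh : ∀ d : Fin m, ∀ t ∈ Set.Ico (s d.castSucc) (s d.succ), h t = e (s d.castSucc)) :
    0 ≤ ∫ t in (0 : ℝ)..T,
        (τ ^ 2 * (e' t ⬝ᵥ (W *ᵥ e' t))
          - (Real.pi ^ 2 / 4) * ((e t - h t) ⬝ᵥ (W *ᵥ (e t - h t)))) := by
  have he : ContinuousOn e (Icc 0 T) := fun t ht ↦ (hderiv t ht).continuousWithinAt
  set F : ℝ → ℝ := fun t ↦ τ ^ 2 * (e' t ⬝ᵥ (W *ᵥ e' t))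
    - (Real.pi ^ 2 / 4) * ((e t - h t) ⬝ᵥ (W *ᵥ (e t - h t))) with hF
  have hQ : Continuous fun v : Fin n → ℝ ↦ v ⬝ᵥ (W *ᵥ v) := by fun_prop
  have piece : ∀ d : Fin m, IntervalIntegrable F volume (s d.castSucc) (s d.succ) ∧
      0 ≤ ∫ t in s d.castSucc..s d.succ, F t := fun d ↦ by
    have hlt : s d.castSucc < s d.succ := hmono d.castSucc_lt_succ
    have h0 : 0 ≤ s d.castSucc := hs0 ▸ hmono.monotone (Fin.zero_le _)
    have h1 : s d.succ ≤ T := hsm ▸ hmono.monotone (Fin.le_last _)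
    have hsub : Icc (s d.castSucc) (s d.succ) ⊆ Icc 0 T := Icc_subset_Icc h0 h1
    have hEq : EqOn (fun t ↦ τ ^ 2 * (e' t ⬝ᵥ (W *ᵥ e' t)) - (Real.pi ^ 2 / 4) *
        ((e t - e (s d.castSucc)) ⬝ᵥ (W *ᵥ (e t - e (s d.castSucc))))) F
        (Ioo (s d.castSucc) (s d.succ)) := fun t ht ↦ by
      simp only [hF, hh d t (Ioo_subset_Ico_self ht)]
    constructor
    · refine IntervalIntegrable.congr_uIoo (ContinuousOn.intervalIntegrable_of_Icc hlt.le ?_)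
        ((uIoo_of_le hlt.le).symm ▸ hEq)
      exact (continuousOn_const.mul (hQ.comp_continuousOn (hcont.mono hsub))).sub
        (continuousOn_const.mul
          (hQ.comp_continuousOn ((he.mono hsub).sub continuousOn_const)))
    · rw [← intervalIntegral.integral_congr_Ioo_of_le hlt.le hEq]
      refine hW.integral_sub_sample_nonneg hlt.le hτ (hstep d) (he.mono hsub) (hcont.mono hsub)
        fun t ht ↦ ?_
      exact (hderiv t (hsub (Ioo_subset_Icc_self ht))).hasDerivAt
        (Icc_mem_nhds (h0.trans_lt ht.1) (ht.2.trans_le h1))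
  have total : ∀ k : Fin (m + 1), IntervalIntegrable F volume 0 (s k) ∧
      0 ≤ ∫ t in (0 : ℝ)..s k, F t := by
    refine Fin.induction (by simp [hs0]) fun d ih ↦ ⟨ih.1.trans (piece d).1, ?_⟩
    rw [← intervalIntegral.integral_add_adjacent_intervals ih.1 (piece d).1]
    exact add_nonneg ih.2 (piece d).2
  exact hsm ▸ (total (Fin.last m)).2
end
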